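/- Mehler kernel formula for the harmonic oscillator: let h_n(x) = (2ⁿ·n!·√π)^{−1/2}·H_n(x)·e^{−x²/2} denote the L²-normalized Hermite functions, where H_n are the physicists' Hermite polynomials. Then for every t>0 and all x,y∈ℝ the series Σ_{n=0}^∞ e^{−t(n+1/2)}·h_n(x)·h_n(y) converges absolutely and equals (2π·sinh t)^{−1/2} · exp( −[ (x²+y²)·cosh t − 2xy ] / (2·sinh t) ). (The h_n form an orthonormal basis of eigenfunctions of the harmonic oscillator (P²+Q²)/2 with eigenvalues n+1/2, so this is the integral kernel of e^{−t(P²+Q²)/2}.) -/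

import Mathlib

open Real

/-- The physicists' Hermite polynomial (as a function):
`H_n(x) = (−1)ⁿ e^{x²} (d/dx)ⁿ e^{−x²}`. -/
noncomputable def physHermite (n : ℕ) (x : ℝ) : ℝ :=
  (-1) ^ n * Real.exp (x ^ 2) * iteratedDeriv n (fun y => Real.exp (-(y ^ 2))) x

/-- The L²-normalized Hermite functions `h_n(x) = (2ⁿ n! √π)^{−1/2} H_n(x) e^{−x²/2}`. -/
noncomputable def hermiteFunction (n : ℕ) (x : ℝ) : ℝ :=
  (Real.sqrt (2 ^ n * (n.factorial : ℝ) * Real.sqrt π))⁻¹ * physHermite n x *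
    Real.exp (-(x ^ 2) / 2)

/-- Differentiating a smooth real function commutes with the coercion to `ℂ`. -/
theorem iteratedDeriv_ofReal_comp {f : ℝ → ℝ} (hf : ContDiff ℝ ⊤ f) (n : ℕ) :
    iteratedDeriv n (fun y => (f y : ℂ)) = fun y => ((iteratedDeriv n f y : ℝ) : ℂ) := by
  induction n with
  | zero => simp
  | succ n ih =>
    rw [iteratedDeriv_succ, ih, iteratedDeriv_succ]
    ext y
    have h : DifferentiableAt ℝ (iteratedDeriv n f) y :=
      (hf.differentiable_iteratedDeriv n (by exact_mod_cast WithTop.coe_lt_top _)) y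
    exact h.hasDerivAt.ofReal_comp.deriv

/-- The Gaussian whose Fourier transform is `y ↦ e^{-y²}`. -/
noncomputable def fourierGaussian (s : ℝ) : ℂ :=
  (√π : ℂ) * Complex.exp (-(π : ℂ) * π * (s : ℂ) ^ 2)

theorem fourierGaussian_eq_ofReal (s : ℝ) :
    fourierGaussian s = ((√π * Real.exp (-π ^ 2 * s ^ 2) : ℝ) : ℂ) := by
  simp [fourierGaussian, pow_two]

theorem continuous_fourierGaussian : Continuous fourierGaussian := by
  unfold fourierGaussian
  fun_prop

theorem cpow_half_ofReal {a : ℝ} (ha : 0 ≤ a) : (a : ℂ) ^ (1 / 2 : ℂ) = (√a : ℂ) := by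
  rw [Real.sqrt_eq_rpow, Complex.ofReal_cpow ha]; simp

open FourierTransform in
theorem fourier_fourierGaussian :
    𝓕 fourierGaussian = fun y : ℝ => ((Real.exp (-(y ^ 2)) : ℝ) : ℂ) := by
  have h := fourier_gaussian_pi (b := (π : ℂ)) (by simpa using pi_pos)
  have h2 : fourierGaussian = (√π : ℂ) • fun s : ℝ => Complex.exp (-(π : ℂ) * π * (s : ℂ) ^ 2) := by
    ext s; simp [fourierGaussian]
  have h3 : ((π : ℂ) ^ (1 / 2 : ℂ)) = (√π : ℂ) := cpow_half_ofReal pi_pos.le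
  have hs : (√π : ℂ) ≠ 0 := by exact_mod_cast (Real.sqrt_pos.2 pi_pos).ne'
  have hp : (π : ℂ) ≠ 0 := by exact_mod_cast pi_pos.ne'
  have h4 : 𝓕 ((√π : ℂ) • fun s : ℝ => Complex.exp (-(π : ℂ) * π * (s : ℂ) ^ 2)) =
      (√π : ℂ) • 𝓕 (fun s : ℝ => Complex.exp (-(π : ℂ) * π * (s : ℂ) ^ 2)) := by
    ext y
    simp only [Real.fourier_eq', Pi.smul_apply, smul_eq_mul, ← MeasureTheory.integral_const_mul]
    congr 1
    ext s
    ring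
  rw [h2, h4, h]
  ext y
  simp only [Pi.smul_apply, smul_eq_mul, h3]
  push_cast
  field_simp

theorem integrable_pow_smul_fourierGaussian (n : ℕ) :
    MeasureTheory.Integrable (fun s : ℝ => s ^ n • fourierGaussian s) := by
  have h := integrable_rpow_mul_exp_neg_mul_sq (b := π ^ 2) (by positivity) (s := n)
    (by linarith [Nat.cast_nonneg (α := ℝ) n])
  have h2 := (h.const_mul √π).ofReal (𝕜 := ℂ)
  refine h2.congr (.of_forall fun s => ?_)
  simp only [fourierGaussian_eq_ofReal, Real.rpow_natCast]
  rw [Complex.real_smul, ← Complex.ofReal_mul]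
  exact congrArg Complex.ofReal (mul_left_comm _ _ _)

/-- Fourier representation of the derivatives of `e^{-y²}`. -/
theorem iteratedDeriv_gaussian_eq_integral (n : ℕ) (x : ℝ) :
    ((iteratedDeriv n (fun y => Real.exp (-(y ^ 2))) x : ℝ) : ℂ) =
      ∫ s : ℝ, Complex.exp ((-2 * π * s * x : ℝ) * Complex.I) *
        ((-2 * π * Complex.I * s) ^ n * fourierGaussian s) := by
  have h := Real.iteratedDeriv_fourier (f := fourierGaussian) (N := ⊤) (n := n)
    (fun m _ => integrable_pow_smul_fourierGaussian m) le_top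
  rw [fourier_fourierGaussian, iteratedDeriv_ofReal_comp (by fun_prop)] at h
  have h2 := congrFun h x
  simp only [Real.fourier_real_eq_integral_exp_smul, smul_eq_mul] at h2
  exact h2

/-- The double Fourier integrand whose integral is the Hermite generating kernel. -/
noncomputable def mehlerIntegrand (r x y : ℝ) (z : ℝ × ℝ) : ℂ :=
  (Complex.exp ((-2 * π * z.1 * x : ℝ) * Complex.I) * fourierGaussian z.1) *
    (Complex.exp ((-2 * π * z.2 * y : ℝ) * Complex.I) * fourierGaussian z.2) *
      Complex.exp ((-2 * π ^ 2 * r * (z.1 * z.2) : ℝ))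

theorem integrable_exp_abs_mul_gaussian {r : ℝ} (h0 : 0 ≤ r) (h1 : r < 1) :
    MeasureTheory.Integrable (fun z : ℝ × ℝ =>
      (√π * Real.exp (-π ^ 2 * z.1 ^ 2)) * (√π * Real.exp (-π ^ 2 * z.2 ^ 2)) *
        Real.exp (2 * π ^ 2 * r * |z.1 * z.2|)) := by
  have hb : 0 < π ^ 2 * (1 - r) := by have := sub_pos.2 h1; positivity
  have h := ((integrable_exp_neg_mul_sq hb).mul_prod (integrable_exp_neg_mul_sq hb)).const_mul π
  refine h.mono' (by fun_prop) (.of_forall fun z => ?_)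
  rw [Real.norm_of_nonneg (by positivity)]
  have hpi : √π * √π = π := Real.mul_self_sqrt pi_pos.le
  calc _ = (√π * √π) * Real.exp (-π ^ 2 * z.1 ^ 2 + -π ^ 2 * z.2 ^ 2
          + 2 * π ^ 2 * r * |z.1 * z.2|) := by
        rw [Real.exp_add, Real.exp_add]; ring
    _ ≤ _ := by
        rw [hpi, ← Real.exp_add]
        refine mul_le_mul_of_nonneg_left (Real.exp_le_exp.2 ?_) pi_pos.le
        have h3 : 2 * |z.1 * z.2| ≤ z.1 ^ 2 + z.2 ^ 2 := by
          rw [abs_mul, ← sq_abs z.1, ← sq_abs z.2]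
          nlinarith [sq_nonneg (|z.1| - |z.2|)]
        have h4 := mul_le_mul_of_nonneg_left h3 (by positivity : 0 ≤ π ^ 2 * r)
        linarith

theorem norm_mehlerIntegrand (r x y : ℝ) (z : ℝ × ℝ) :
    ‖mehlerIntegrand r x y z‖ =
      (√π * Real.exp (-π ^ 2 * z.1 ^ 2)) * (√π * Real.exp (-π ^ 2 * z.2 ^ 2)) *
        Real.exp (-2 * π ^ 2 * r * (z.1 * z.2)) := by
  simp only [mehlerIntegrand, norm_mul, Complex.norm_exp_ofReal_mul_I, fourierGaussian_eq_ofReal,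
    Complex.norm_real, ← Complex.ofReal_exp, one_mul, Real.norm_eq_abs, Real.abs_exp,
    abs_of_nonneg (Real.sqrt_nonneg _)]

theorem integrable_mehlerIntegrand {r : ℝ} (h0 : 0 ≤ r) (h1 : r < 1) (x y : ℝ) :
    MeasureTheory.Integrable (mehlerIntegrand r x y) := by
  refine (integrable_exp_abs_mul_gaussian h0 h1).mono' ?_ (.of_forall fun z => ?_)
  · have := continuous_fourierGaussian
    exact Continuous.aestronglyMeasurable (by unfold mehlerIntegrand; fun_prop)
  · rw [norm_mehlerIntegrand]
    refine mul_le_mul_of_nonneg_left (Real.exp_le_exp.2 ?_) (by positivity)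
    have h3 := mul_le_mul_of_nonneg_left (neg_le_abs (z.1 * z.2))
      (by positivity : 0 ≤ 2 * π ^ 2 * r)
    linarith

theorem integral_mehlerIntegrand {r : ℝ} (h0 : 0 ≤ r) (h1 : r < 1) (x y : ℝ) :
    ∫ z, mehlerIntegrand r x y z =
      (((√(1 - r ^ 2))⁻¹ *
        Real.exp (-((x ^ 2 + y ^ 2 - 2 * r * x * y) / (1 - r ^ 2))) : ℝ) : ℂ) := by
  have hr : 0 < 1 - r ^ 2 := by nlinarith
  have hrc : (1 - (r : ℂ) ^ 2) ≠ 0 := by exact_mod_cast hr.ne'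
  have hpc : (π : ℂ) ≠ 0 := by exact_mod_cast pi_pos.ne'
  have hpi : (√π : ℂ) * √π = π := by exact_mod_cast Real.mul_self_sqrt pi_pos.le
  have hI : Complex.I ^ 2 = -1 := Complex.I_sq
  rw [MeasureTheory.Measure.volume_eq_prod, MeasureTheory.integral_prod_symm _
    (by rw [← MeasureTheory.Measure.volume_eq_prod]; exact integrable_mehlerIntegrand h0 h1 x y)]
  have inner (u : ℝ) : ∫ s : ℝ, mehlerIntegrand r x y (s, u) =
      (π * √(π⁻¹) : ℂ) * Complex.exp ((-(π ^ 2 * (1 - r ^ 2) : ℝ) : ℂ) * (u : ℂ) ^ 2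
        + (2 * π * (r * x - y) * Complex.I) * u + (-(x : ℂ) ^ 2)) := by
    have e (s : ℝ) : mehlerIntegrand r x y (s, u) = π * Complex.exp ((-(π ^ 2 : ℝ) : ℂ) *
        (s : ℂ) ^ 2 + (-2 * π ^ 2 * r * u - 2 * π * x * Complex.I) * s
          + (-2 * π * u * y * Complex.I - π ^ 2 * u ^ 2)) := by
      calc _ = (√π * √π : ℂ) * (Complex.exp ((-2 * π * s * x : ℝ) * Complex.I) *
              Complex.exp (-(π : ℂ) * π * (s : ℂ) ^ 2) *
              Complex.exp ((-2 * π * u * y : ℝ) * Complex.I) *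
              Complex.exp (-(π : ℂ) * π * (u : ℂ) ^ 2) *
              Complex.exp ((-2 * π ^ 2 * r * (s * u) : ℝ))) := by
            simp only [mehlerIntegrand, fourierGaussian]; ring
        _ = _ := by
            simp only [hpi, ← Complex.exp_add]
            congr 2
            push_cast
            ring
    simp only [e, MeasureTheory.integral_const_mul]
    rw [integral_cexp_quadratic (by rw [← Complex.ofReal_neg, Complex.ofReal_re]; simp [pi_pos])]
    have h5 : (π : ℂ) / -(-(π ^ 2 : ℝ) : ℂ) = ((π⁻¹ : ℝ) : ℂ) := by
      push_cast; field_simp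
    rw [h5, cpow_half_ofReal (by positivity), ← mul_assoc]
    congr 2
    push_cast
    field_simp
    ring_nf
    simp only [hI]
    ring
  simp only [inner, MeasureTheory.integral_const_mul]
  rw [integral_cexp_quadratic (by
    rw [← Complex.ofReal_neg, Complex.ofReal_re]
    linarith [mul_pos (pow_pos pi_pos 2) hr])]
  have h5 : (π : ℂ) / -(-(π ^ 2 * (1 - r ^ 2) : ℝ) : ℂ) = ((π⁻¹ * (1 - r ^ 2)⁻¹ : ℝ) : ℂ) := by
    push_cast; field_simp
  rw [h5, cpow_half_ofReal (by positivity), Real.sqrt_mul (by positivity), ← mul_assoc]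
  have h6 : (π * √(π⁻¹) * (√(π⁻¹) * √((1 - r ^ 2)⁻¹)) : ℝ) = (√(1 - r ^ 2))⁻¹ := by
    have := Real.mul_self_sqrt (by positivity : (0 : ℝ) ≤ π⁻¹)
    rw [Real.sqrt_inv (1 - r ^ 2)]
    calc _ = π * (√(π⁻¹) * √(π⁻¹)) * (√(1 - r ^ 2))⁻¹ := by ring
      _ = _ := by rw [this, mul_inv_cancel₀ pi_pos.ne', one_mul]
  rw [← h6]
  push_cast
  congr 2
  field_simp
  ring_nf
  simp only [hI]
  ring

/-- Mehler's formula for the derivatives of the Gaussian. -/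
theorem hasSum_iteratedDeriv_gaussian {r : ℝ} (h0 : 0 ≤ r) (h1 : r < 1) (x y : ℝ) :
    HasSum (fun n : ℕ => (r / 2) ^ n / (n.factorial : ℝ) *
        (iteratedDeriv n (fun y => Real.exp (-(y ^ 2))) x *
          iteratedDeriv n (fun y => Real.exp (-(y ^ 2))) y))
      ((√(1 - r ^ 2))⁻¹ * Real.exp (-((x ^ 2 + y ^ 2 - 2 * r * x * y) / (1 - r ^ 2)))) := by
  set F : ℕ → ℝ × ℝ → ℂ := fun n z => mehlerIntegrand 0 x y z *
    (((-2 * π ^ 2 * r * (z.1 * z.2) : ℝ) : ℂ) ^ n / (n.factorial : ℂ)) with hF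
  have hexp (a : ℝ) : HasSum (fun n : ℕ => a ^ n / (n.factorial : ℝ)) (Real.exp a) := by
    rw [Real.exp_eq_exp_ℝ]; exact NormedSpace.expSeries_div_hasSum_exp a
  have hcexp (a : ℂ) : HasSum (fun n : ℕ => a ^ n / (n.factorial : ℂ)) (Complex.exp a) := by
    rw [Complex.exp_eq_exp_ℂ]; exact NormedSpace.expSeries_div_hasSum_exp a
  have hnorm (n : ℕ) (z : ℝ × ℝ) : ‖F n z‖ =
      (√π * Real.exp (-π ^ 2 * z.1 ^ 2)) * (√π * Real.exp (-π ^ 2 * z.2 ^ 2)) *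
        ((2 * π ^ 2 * r * |z.1 * z.2|) ^ n / (n.factorial : ℝ)) := by
    have : |(-2 * π ^ 2 * r * (z.1 * z.2))| = 2 * π ^ 2 * r * |z.1 * z.2| := by
      rw [abs_mul, show -2 * π ^ 2 * r = -(2 * π ^ 2 * r) by ring, abs_neg,
        abs_of_nonneg (by positivity)]
    simp only [hF, norm_mul, norm_mehlerIntegrand, norm_div, norm_pow, Complex.norm_real,
      Complex.norm_natCast, Real.norm_eq_abs (-2 * π ^ 2 * r * (z.1 * z.2)), this]
    simp
  have hb (z : ℝ × ℝ) := (hexp (2 * π ^ 2 * r * |z.1 * z.2|)).mul_left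
    ((√π * Real.exp (-π ^ 2 * z.1 ^ 2)) * (√π * Real.exp (-π ^ 2 * z.2 ^ 2)))
  have key : HasSum (fun n => ∫ z, F n z) (∫ z, mehlerIntegrand r x y z) := by
    refine MeasureTheory.hasSum_integral_of_dominated_convergence (fun n z => ‖F n z‖)
      (fun n => ?_) (fun n => .of_forall fun z => le_rfl) (.of_forall fun z => ?_) ?_
      (.of_forall fun z => ?_)
    · exact (integrable_mehlerIntegrand le_rfl one_pos x y).aestronglyMeasurable.mul
        (Continuous.aestronglyMeasurable (by fun_prop))
    · simpa only [hnorm] using (hb z).summable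
    · simp only [hnorm, fun z => (hb z).tsum_eq]
      exact integrable_exp_abs_mul_gaussian h0 h1
    · have := (hcexp ((-2 * π ^ 2 * r * (z.1 * z.2) : ℝ) : ℂ)).mul_left (mehlerIntegrand 0 x y z)
      have e : mehlerIntegrand r x y z =
          mehlerIntegrand 0 x y z * Complex.exp ((-2 * π ^ 2 * r * (z.1 * z.2) : ℝ) : ℂ) := by
        simp [mehlerIntegrand]
      rw [e]
      exact this
  rw [integral_mehlerIntegrand h0 h1] at key
  refine Complex.hasSum_ofReal.1 (key.congr_fun fun n => ?_)
  push_cast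
  rw [iteratedDeriv_gaussian_eq_integral, iteratedDeriv_gaussian_eq_integral,
    ← MeasureTheory.integral_prod_mul, ← MeasureTheory.integral_const_mul,
    ← MeasureTheory.Measure.volume_eq_prod]
  congr 1
  ext z
  have hpow : (((-2 * π ^ 2 * r * (z.1 * z.2) : ℝ) : ℂ)) ^ n =
      ((r : ℂ) / 2) ^ n * (-2 * π * Complex.I * z.1) ^ n * (-2 * π * Complex.I * z.2) ^ n := by
    rw [← mul_pow, ← mul_pow]
    congr 1
    push_cast
    linear_combination (-2 * (π : ℂ) ^ 2 * r * z.1 * z.2) * Complex.I_sq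
  simp only [hF, hpow, mehlerIntegrand, mul_zero, zero_mul, Complex.ofReal_zero, Complex.exp_zero]
  ring

/-- **Mehler kernel formula for the harmonic oscillator.**  For every `t > 0` and all
`x, y ∈ ℝ`, the series `Σ_{n=0}^∞ e^{−t(n+1/2)} h_n(x) h_n(y)` converges absolutely and
equals `(2π sinh t)^{−1/2} exp(−[(x²+y²) cosh t − 2xy]/(2 sinh t))`. -/
theorem mehler_kernel_formula :
    ∀ t : ℝ, 0 < t → ∀ x y : ℝ,
      Summable (fun n : ℕ =>
        |Real.exp (-t * ((n : ℝ) + 1 / 2)) * hermiteFunction n x * hermiteFunction n y|) ∧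
      (∑' n : ℕ, Real.exp (-t * ((n : ℝ) + 1 / 2)) * hermiteFunction n x * hermiteFunction n y)
        = (Real.sqrt (2 * π * Real.sinh t))⁻¹ *
            Real.exp (-(((x ^ 2 + y ^ 2) * Real.cosh t - 2 * x * y) / (2 * Real.sinh t))) := by
  intro t ht x y
  set r := Real.exp (-t) with hr
  have h0 : 0 < r := Real.exp_pos _
  have h1 : r < 1 := by rw [hr, Real.exp_lt_one_iff]; linarith
  have h2 : 0 < 1 - r ^ 2 := by nlinarith
  have hrt : Real.exp t = r⁻¹ := by rw [hr, Real.exp_neg, inv_inv]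
  have hsinh : Real.sinh t = (1 - r ^ 2) / (2 * r) := by
    rw [Real.sinh_eq, hrt, ← hr]; field_simp
  have hcosh : Real.cosh t = (1 + r ^ 2) / (2 * r) := by
    rw [Real.cosh_eq, hrt, ← hr]; field_simp
  have hsum := (hasSum_iteratedDeriv_gaussian h0.le h1 x y).mul_left
    (√r * (√π)⁻¹ * Real.exp ((x ^ 2 + y ^ 2) / 2))
  have hterm (n : ℕ) : Real.exp (-t * ((n : ℝ) + 1 / 2)) * hermiteFunction n x *
      hermiteFunction n y = √r * (√π)⁻¹ * Real.exp ((x ^ 2 + y ^ 2) / 2) *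
        ((r / 2) ^ n / (n.factorial : ℝ) *
        (iteratedDeriv n (fun y => Real.exp (-(y ^ 2))) x *
          iteratedDeriv n (fun y => Real.exp (-(y ^ 2))) y)) := by
    have e1 : Real.exp (-t * ((n : ℝ) + 1 / 2)) = r ^ n * √r := by
      rw [hr, ← Real.exp_nat_mul, Real.sqrt_eq_rpow, ← Real.exp_mul, ← Real.exp_add]
      congr 1; ring
    have e2 (x : ℝ) : Real.exp (x ^ 2) * Real.exp (-(x ^ 2) / 2) = Real.exp (x ^ 2 / 2) := by
      rw [← Real.exp_add]; congr 1; ring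
    have e3 : (√(2 ^ n * (n.factorial : ℝ) * √π))⁻¹ * (√(2 ^ n * (n.factorial : ℝ) * √π))⁻¹ =
        (2 ^ n * (n.factorial : ℝ) * √π)⁻¹ := by
      rw [← mul_inv, Real.mul_self_sqrt (by positivity)]
    have e4 : ((-1 : ℝ) ^ n) * (-1) ^ n = 1 := by rw [← mul_pow]; simp
    simp only [hermiteFunction, physHermite]
    rw [e1, add_div, Real.exp_add, ← e2 x, ← e2 y]
    calc _ = r ^ n * √r * ((√(2 ^ n * (n.factorial : ℝ) * √π))⁻¹ *
            (√(2 ^ n * (n.factorial : ℝ) * √π))⁻¹) * (((-1 : ℝ) ^ n) * (-1) ^ n) *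
            (Real.exp (x ^ 2) * Real.exp (-(x ^ 2) / 2) *
              (Real.exp (y ^ 2) * Real.exp (-(y ^ 2) / 2))) *
            (iteratedDeriv n (fun y => Real.exp (-(y ^ 2))) x *
              iteratedDeriv n (fun y => Real.exp (-(y ^ 2))) y) := by ring
      _ = _ := by
        rw [e3, e4, div_pow, mul_inv, mul_inv, div_eq_mul_inv, div_eq_mul_inv]
        ring
  simp only [hterm]
  refine ⟨hsum.summable.abs, hsum.tsum_eq.trans ?_⟩
  have e5 : (√(2 * π * Real.sinh t))⁻¹ = √r * (√π)⁻¹ * (√(1 - r ^ 2))⁻¹ := by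
    rw [hsinh, show 2 * π * ((1 - r ^ 2) / (2 * r)) = π * (1 - r ^ 2) / r by field_simp,
      Real.sqrt_div (by positivity), Real.sqrt_mul pi_pos.le, inv_div, div_eq_mul_inv, mul_inv,
      mul_assoc]
  have e6 : -(((x ^ 2 + y ^ 2) * Real.cosh t - 2 * x * y) / (2 * Real.sinh t)) =
      (x ^ 2 + y ^ 2) / 2 + -((x ^ 2 + y ^ 2 - 2 * r * x * y) / (1 - r ^ 2)) := by
    rw [hsinh, hcosh]
    field_simp
    ring
  rw [e5, e6, Real.exp_add]
  ring
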